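/- If x ∈ ℝ^n satisfies e_{d-1}(x) = 0, then |e_d(x)| ≥ (C(n,d) / (2n^{d+1})^{n-d}) · m_d(x), where m_d(x) is the product of the d largest coordinates of x in absolute value. -/

import Mathlib

open Finset

/-- The `k`-th elementary symmetric polynomial of `x 1, ..., x n`. -/
noncomputable def esymm (n k : ℕ) (x : Fin n → ℝ) : ℝ :=
  ∑ S ∈ Finset.powersetCard k (Finset.univ : Finset (Fin n)), ∏ i ∈ S, x i

/-- `m_d(x)`: the product of the `d` largest coordinates of `x` in absolute value. -/
noncomputable def mProd (n d : ℕ) (hdn : d ≤ n) (x : Fin n → ℝ) : ℝ :=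
  (Finset.powersetCard d (Finset.univ : Finset (Fin n))).sup'
    (Finset.powersetCard_nonempty.2 (by simpa using hdn))
    (fun S => ∏ i ∈ S, |x i|)

section RealRooted

open Polynomial

theorem splits_derivative_of_splits {p : ℝ[X]} (hp : p.Splits) : (derivative p).Splits := by
  have h1 := card_roots_le_derivative p
  have h2 := splits_iff_card_roots.1 hp
  have h3 := natDegree_derivative_le p
  have h4 := card_roots' (derivative p)
  by_cases h0 : p.natDegree = 0
  · exact Splits.of_natDegree_eq_zero (by omega)
  · exact splits_iff_card_roots.2 (by omega)

theorem two_mul_coeff_zero_mul_coeff_two_le {p : ℝ[X]} (hp : p.Splits) :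
    2 * (p.coeff 0 * p.coeff 2) ≤ p.coeff 1 ^ 2 := by
  obtain ⟨m, hm⟩ := splits_iff_exists_multiset.1 hp
  have key : ∀ m : Multiset ℝ, ∀ q : ℝ[X], q = (m.map (fun b => X - C b)).prod →
      2 * (q.coeff 0 * q.coeff 2) ≤ q.coeff 1 ^ 2 := by
    intro m
    induction m using Multiset.induction with
    | empty =>
      rintro q rfl
      simp [coeff_one]
    | cons b m ih =>
      rintro q rfl
      have h := ih _ rfl
      set g := (m.map (fun b => X - C b)).prod
      have h1 : ((X - C b) * g).coeff 1 = g.coeff 0 - b * g.coeff 1 := by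
        simp [sub_mul, coeff_X_mul g 0]
      have h2 : ((X - C b) * g).coeff 2 = g.coeff 1 - b * g.coeff 2 := by
        simp [sub_mul, coeff_X_mul g 1]
      have h0 : ((X - C b) * g).coeff 0 = - (b * g.coeff 0) := by
        simp [sub_mul]
      rw [Multiset.map_cons, Multiset.prod_cons, h0, h1, h2]
      nlinarith [mul_le_mul_of_nonneg_left h (sq_nonneg b), sq_nonneg (g.coeff 0)]
  have h := mul_le_mul_of_nonneg_left (key m _ rfl) (sq_nonneg p.leadingCoeff)
  rw [hm]
  simp only [coeff_C_mul]
  linarith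

/-- A form of Newton's inequality for the coefficients of a real-rooted polynomial. -/
theorem newton_inequality_coeff (r : ℕ) : ∀ {p : ℝ[X]}, p.Splits →
    ((r : ℝ) + 2) * (p.coeff r * p.coeff (r + 2)) ≤ (r + 1) * p.coeff (r + 1) ^ 2 := by
  induction r with
  | zero =>
    intro p hp
    simpa using two_mul_coeff_zero_mul_coeff_two_le hp
  | succ r ih =>
    intro p hp
    have h := ih (splits_derivative_of_splits hp)
    simp only [coeff_derivative] at h
    push_cast at h ⊢
    have hr : (0 : ℝ) < ((r : ℝ) + 1) * (r + 2) := by positivity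
    rw [show r + 1 + 2 = r + 2 + 1 by ring]
    refine le_of_mul_le_mul_left ?_ hr
    linarith

end RealRooted

section Esymm

variable {ι : Type*}

theorem newton_inequality_esymm (s : Finset ι) (x : ι → ℝ) (j r : ℕ) (hs : #s = j + 2 + r) :
    ((r : ℝ) + 2) * ((∑ S ∈ powersetCard (j + 2) s, ∏ i ∈ S, x i) *
      ∑ S ∈ powersetCard j s, ∏ i ∈ S, x i) ≤
      (r + 1) * (∑ S ∈ powersetCard (j + 1) s, ∏ i ∈ S, x i) ^ 2 := by
  have hsplit : (∏ i ∈ s, (Polynomial.X + Polynomial.C (x i))).Splits :=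
    Polynomial.Splits.prod fun i _ => Polynomial.Splits.X_add_C _
  have h := newton_inequality_coeff r hsplit
  rwa [Finset.prod_X_add_C_coeff s x (by omega), Finset.prod_X_add_C_coeff s x (by omega),
    Finset.prod_X_add_C_coeff s x (by omega), show #s - r = j + 2 by omega,
    show #s - (r + 1) = j + 1 by omega, show #s - (r + 2) = j by omega] at h

theorem sum_powersetCard_succ_prod_erase [DecidableEq ι] (s : Finset ι) (x : ι → ℝ) {i : ι} (hi : i ∈ s) (k : ℕ) :
    ∑ S ∈ powersetCard (k + 1) s, ∏ j ∈ S, x j =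
      (∑ S ∈ powersetCard (k + 1) (s.erase i), ∏ j ∈ S, x j) +
        x i * ∑ S ∈ powersetCard k (s.erase i), ∏ j ∈ S, x j := by
  have hn : i ∉ s.erase i := notMem_erase i s
  have hT : ∀ T ∈ powersetCard k (s.erase i), i ∉ T := fun T h hmem =>
    hn ((mem_powersetCard.1 h).1 hmem)
  conv_lhs => rw [← insert_erase hi, powersetCard_succ_insert hn]
  rw [sum_union, sum_image, mul_sum]
  · congr 1
    exact sum_congr rfl fun T h => prod_insert (hT T h)
  · intro A hA B hB hAB
    rw [← erase_insert (hT A hA), ← erase_insert (hT B hB)]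
    exact congrArg (fun T => erase T i) hAB
  · rw [disjoint_left]
    intro A hA hB
    obtain ⟨B, -, rfl⟩ := mem_image.1 hB
    exact hn ((mem_powersetCard.1 hA).1 (mem_insert_self i B))

theorem abs_mul_le_of_newton {a u v w ε r : ℝ} (hr : 0 ≤ r)
    (hv : |v + a * u| ≤ ε) (hw : |a| * |u + a * w| ≤ ε)
    (hN : (r + 2) * (v * w) ≤ (r + 1) * u ^ 2) :
    |a| * |u| ≤ 2 * (r + 2) * ε := by
  have hε : 0 ≤ ε := (abs_nonneg _).trans hv
  rw [← abs_mul] at hw ⊢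
  by_contra! hlt
  have hN' : (r + 2) * (v * (a ^ 2 * w)) ≤ (r + 1) * (a * u) ^ 2 := by
    nlinarith [mul_le_mul_of_nonneg_left hN (sq_nonneg a)]
  obtain ⟨hv1, hv2⟩ := abs_le.1 hv
  obtain ⟨hw1, hw2⟩ := abs_le.1 hw
  set b := a * u with hb
  set z := a ^ 2 * w with hz
  have hbz : a * (u + a * w) = b + z := by rw [hb, hz]; ring
  rw [hbz] at hw1 hw2
  have hge : ε ≤ |b| := by nlinarith
  have hprod : (|b| - ε) ^ 2 ≤ v * z := by
    rcases abs_cases b with ⟨h1, -⟩ | ⟨h1, -⟩ <;> rw [h1] at hge ⊢ <;>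
      nlinarith
  have hsq : b ^ 2 = |b| ^ 2 := (sq_abs b).symm
  have : (r + 2) * (|b| - ε) ^ 2 ≤ (r + 1) * |b| ^ 2 := by
    rw [← hsq]
    exact (mul_le_mul_of_nonneg_left hprod (by linarith)).trans hN'
  have hpos : 0 < |b| := lt_of_le_of_lt (by positivity) hlt
  nlinarith [mul_nonneg (add_nonneg hr zero_le_two) (sq_nonneg ε), mul_lt_mul_of_pos_right hlt hpos]

/-- If `e_k` and `e_{k+1}` are both small then so is every product of `k + 1` coordinates. -/
theorem prod_abs_le_of_esymm_small [DecidableEq ι] (x : ι → ℝ) (r k : ℕ) : ∀ (s : Finset ι) (ε : ℝ),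
    #s = k + 2 + r →
    (∀ i ∈ s, |x i| * |∑ S ∈ powersetCard k s, ∏ i ∈ S, x i| ≤ ε) →
    |∑ S ∈ powersetCard (k + 1) s, ∏ i ∈ S, x i| ≤ ε →
    ∀ T ∈ powersetCard (k + 1) s, ∏ i ∈ T, |x i| ≤ (2 * r + 5) ^ k * ε := by
  induction k with
  | zero =>
    intro s ε _ h _ T hT
    obtain ⟨hTs, hTc⟩ := mem_powersetCard.1 hT
    obtain ⟨i, rfl⟩ := card_eq_one.1 hTc
    simpa using h i (hTs (mem_singleton_self i))
  | succ k ih =>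
    intro s ε hs h0 h1 T hT
    obtain ⟨hTs, hTc⟩ := mem_powersetCard.1 hT
    have hε : 0 ≤ ε := (abs_nonneg _).trans h1
    obtain ⟨i, hi, hmax⟩ := exists_max_image s (fun i => |x i|) (card_pos.1 (by omega))
    obtain ⟨j, hjT, hj⟩ : ∃ j ∈ T, T.erase j ⊆ s.erase i := by
      by_cases hiT : i ∈ T
      · exact ⟨i, hiT, erase_subset_erase i hTs⟩
      · obtain ⟨j, hj⟩ := card_pos.1 (show 0 < #T by omega)
        exact ⟨j, hj, fun l hl => mem_erase.2
          ⟨fun h => hiT (h ▸ mem_of_mem_erase hl), hTs (mem_of_mem_erase hl)⟩⟩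
    rw [← mul_prod_erase T (fun i => |x i|) hjT]
    have hjm : |x j| ≤ |x i| := hmax j (hTs hjT)
    rcases (abs_nonneg (x i)).eq_or_lt with hA | hA
    · rw [← hA] at hjm
      rw [le_antisymm hjm (abs_nonneg _), zero_mul]
      positivity
    have hcard : #(s.erase i) = k + 2 + r := by rw [card_erase_of_mem hi]; omega
    have hN := newton_inequality_esymm (s.erase i) x k r hcard
    have h0i := h0 i hi
    rw [sum_powersetCard_succ_prod_erase s x hi] at h0i h1
    have hu := abs_mul_le_of_newton (Nat.cast_nonneg r) h1 h0i hN
    set u := ∑ S ∈ powersetCard (k + 1) (s.erase i), ∏ i ∈ S, x i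
    set w := ∑ S ∈ powersetCard k (s.erase i), ∏ i ∈ S, x i
    have hw : |x i| * |w| ≤ (2 * r + 5) * ε / |x i| := by
      rw [le_div_iff₀ hA]
      have : |x i * w| ≤ |u + x i * w| + |u| := by
        simpa using abs_sub (u + x i * w) u
      rw [abs_mul] at this
      nlinarith
    have hu' : |u| ≤ (2 * r + 5) * ε / |x i| := by
      rw [le_div_iff₀ hA]
      nlinarith
    have hP := ih (s.erase i) ((2 * r + 5) * ε / |x i|) hcard
      (fun l hl => (mul_le_mul_of_nonneg_right (hmax l (mem_of_mem_erase hl))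
        (abs_nonneg w)).trans hw) hu' (T.erase j)
      (mem_powersetCard.2 ⟨hj, by rw [card_erase_of_mem hjT]; omega⟩)
    calc |x j| * ∏ i ∈ T.erase j, |x i|
        ≤ |x i| * ((2 * r + 5) ^ k * ((2 * r + 5) * ε / |x i|)) :=
          mul_le_mul hjm hP (prod_nonneg fun _ _ => abs_nonneg _) hA.le
      _ = (2 * r + 5) ^ (k + 1) * ε := by
          field_simp
          ring

end Esymm

theorem pow_le_add_pow (r k : ℕ) : (2 * r + 5) ^ k ≤ (k + 2 + r) ^ ((k + 1) * (r + 1)) := by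
  rcases r.eq_zero_or_pos with rfl | hr
  · rcases lt_or_ge k 3 with hk | hk
    · interval_cases k <;> norm_num
    · calc (2 * 0 + 5) ^ k ≤ (k + 2 + 0) ^ k := Nat.pow_le_pow_left (by omega) k
        _ ≤ _ := Nat.pow_le_pow_right (by omega) (by omega)
  · rcases k.eq_zero_or_pos with rfl | hk
    · simpa using Nat.one_le_pow _ _ (by omega)
    · calc (2 * r + 5) ^ k ≤ ((k + 2 + r) ^ 2) ^ k := Nat.pow_le_pow_left (by nlinarith) k
        _ = (k + 2 + r) ^ (2 * k) := (pow_mul _ _ _).symm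
        _ ≤ _ := Nat.pow_le_pow_right (by omega) (by nlinarith)

theorem choose_mul_pow_le (r k : ℕ) :
    (k + 2 + r).choose (k + 1) * (2 * r + 5) ^ k ≤
      (2 * (k + 2 + r) ^ (k + 2)) ^ (r + 1) := by
  have h1 : (k + 2 + r).choose (k + 1) ≤ (k + 2 + r) ^ (r + 1) := by
    rw [← Nat.choose_symm_of_eq_add (show k + 2 + r = (r + 1) + (k + 1) by ring)]
    exact Nat.choose_le_pow _ _
  calc (k + 2 + r).choose (k + 1) * (2 * r + 5) ^ k
      ≤ (k + 2 + r) ^ (r + 1) * (k + 2 + r) ^ ((k + 1) * (r + 1)) :=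
        Nat.mul_le_mul h1 (pow_le_add_pow r k)
    _ = ((k + 2 + r) ^ (k + 2)) ^ (r + 1) := by
        rw [← pow_add, ← pow_mul]
        congr 1
        ring
    _ ≤ _ := Nat.pow_le_pow_left (by omega) _

/-- If `x ∈ ℝⁿ` satisfies `e_{d-1}(x) = 0`, then
`|e_d(x)| ≥ (C(n,d) / (2n^{d+1})^{n-d}) · m_d(x)`. -/
theorem esymm_lower_bound_of_esymm_pred_eq_zero (n d : ℕ) (hd : 1 ≤ d) (hdn : d ≤ n)
    (x : Fin n → ℝ) (h : esymm n (d - 1) x = 0) :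
    |esymm n d x| ≥
      ((n.choose d : ℝ) / (2 * (n : ℝ) ^ (d + 1)) ^ (n - d)) * mProd n d hdn x := by
  obtain ⟨T, hT, hmT⟩ := exists_mem_eq_sup'
    (powersetCard_nonempty.2 (show d ≤ #(univ : Finset (Fin n)) by simpa using hdn))
    (fun S : Finset (Fin n) => ∏ i ∈ S, |x i|)
  have hm : mProd n d hdn x = ∏ i ∈ T, |x i| := hmT
  rw [hm, ge_iff_le]
  obtain ⟨k, rfl⟩ : ∃ k, d = k + 1 := ⟨d - 1, by omega⟩
  rcases hdn.eq_or_lt with rfl | hlt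
  · have hTu : T = univ := by
      rw [← card_eq_iff_eq_univ, (mem_powersetCard.1 hT).2, Fintype.card_fin]
    have he : esymm (k + 1) (k + 1) x = ∏ i, x i := by
      have := powersetCard_self (univ : Finset (Fin (k + 1)))
      rw [card_univ, Fintype.card_fin] at this
      rw [esymm, this, sum_singleton]
    rw [he, hTu, abs_prod]
    simp
  · obtain ⟨r, rfl⟩ : ∃ r, n = k + 2 + r := ⟨n - (k + 2), by omega⟩
    have hsub : k + 2 + r - (k + 1) = r + 1 := by omega
    rw [Nat.add_sub_cancel] at h
    have hP := prod_abs_le_of_esymm_small x r k univ |esymm (k + 2 + r) (k + 1) x|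
      (by simp) (fun i _ => by
        change |x i| * |esymm (k + 2 + r) k x| ≤ _
        rw [h]
        simp) le_rfl T hT
    have hc : (((k + 2 + r).choose (k + 1) : ℕ) : ℝ) * (2 * r + 5) ^ k ≤
        (2 * ((k + 2 + r : ℕ) : ℝ) ^ (k + 1 + 1)) ^ (r + 1) := by
      exact_mod_cast choose_mul_pow_le r k
    rw [hsub, div_mul_eq_mul_div, div_le_iff₀ (by positivity)]
    calc (((k + 2 + r).choose (k + 1) : ℕ) : ℝ) * ∏ i ∈ T, |x i|
        ≤ ((k + 2 + r).choose (k + 1) : ℕ) *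
          ((2 * r + 5) ^ k * |esymm (k + 2 + r) (k + 1) x|) := by gcongr
      _ = ((k + 2 + r).choose (k + 1) : ℕ) * (2 * r + 5) ^ k *
          |esymm (k + 2 + r) (k + 1) x| := by ring
      _ ≤ _ := by
        rw [mul_comm |_|]
        gcongr
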